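/- arXiv:2003.01887 — 7 statements merged into one kernel-verified Lean document; each statement's English description precedes it below -/
import Mathlib

section
/- Let X be a finite set, K a positive integer, S : X → X → ℝ symmetric with 0 ≤ S u v ≤ 1 for all u, v, and B > 0. If q : X → Fin K → ℝ is a binary assignment (each q u c ∈ {0,1}) that minimizes the correlation-clustering QUBO energy E_corr over all binary assignments, then for every point u ∈ X, Σ_c q u c ≤ 1; that is, no point is assigned to more than one cluster in an optimal solution. -/
open Finset

/-- Sum of a (symmetric) function over unordered pairs `{u,v}` of distinct points:
half of the sum over ordered pairs of distinct points. -/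
noncomputable def pairSum {X : Type} [Fintype X] [DecidableEq X] (f : X → X → ℝ) : ℝ :=
  (∑ p ∈ (Finset.univ : Finset X).offDiag, f p.1 p.2) / 2

/-- The correlation-clustering QUBO energy with penalty weight `B`. -/
noncomputable def Ecorr {X : Type} [Fintype X] [DecidableEq X] {K : ℕ}
    (S : X → X → ℝ) (B : ℝ) (q : X → Fin K → ℝ) : ℝ :=
  pairSum (fun u v =>
      (1 - S u v) * ∑ c : Fin K, q u c * q v c
        + S u v * ∑ p ∈ (Finset.univ : Finset (Fin K)).offDiag, q u p.1 * q v p.2)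
    + B * ∑ u : X, (∑ c : Fin K, q u c - 1) ^ 2

/-- if a binary assignment `q` minimizes the correlation-clustering QUBO
energy `E_corr` (with `0 ≤ S ≤ 1` symmetric and `B > 0`) over all binary assignments,
then no point is assigned to more than one cluster: `Σ_c q u c ≤ 1` for every `u`. -/
theorem minimizer_Ecorr_at_most_one_cluster
    {X : Type} [Fintype X] [DecidableEq X] (K : ℕ) (hK : 0 < K)
    (S : X → X → ℝ) (hSsymm : ∀ u v : X, S u v = S v u)
    (hS0 : ∀ u v : X, 0 ≤ S u v) (hS1 : ∀ u v : X, S u v ≤ 1)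
    (B : ℝ) (hB : 0 < B)
    (q : X → Fin K → ℝ) (hbin : ∀ (u : X) (c : Fin K), q u c = 0 ∨ q u c = 1)
    (hmin : ∀ q' : X → Fin K → ℝ, (∀ (u : X) (c : Fin K), q' u c = 0 ∨ q' u c = 1) →
      Ecorr S B q ≤ Ecorr S B q') :
    ∀ u : X, ∑ c : Fin K, q u c ≤ 1 := by
  intro u
  by_contra hu
  push Not at hu
  have hnn : ∀ v c, 0 ≤ q v c := fun v c => by
    rcases hbin v c with h | h <;> rw [h]
    norm_num
  obtain ⟨c, hc⟩ : ∃ c, q u c = 1 := by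
    by_contra hne
    push Not at hne
    have h0 : ∑ c : Fin K, q u c = 0 :=
      Finset.sum_eq_zero fun c _ => (hbin u c).resolve_right (hne c)
    linarith
  let q' : X → Fin K → ℝ := fun v d => if v = u then (if d = c then 1 else 0) else q v d
  have hbin' : ∀ v d, q' v d = 0 ∨ q' v d = 1 := by
    intro v d
    simp only [q']
    split_ifs
    · exact Or.inr rfl
    · exact Or.inl rfl
    · exact hbin v d
  have hnn' : ∀ v d, 0 ≤ q' v d := fun v d => by
    rcases hbin' v d with h | h <;> rw [h]
    norm_num
  have hle : ∀ v d, q' v d ≤ q v d := by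
    intro v d
    simp only [q']
    split_ifs with h1 h2
    · rw [h1, h2, hc]
    · exact hnn v d
    · exact le_rfl
  have hmul : ∀ v w d e, q' v d * q' w e ≤ q v d * q w e := fun v w d e =>
    mul_le_mul (hle v d) (hle w e) (hnn' w e) (hnn v d)
  have hsu : ∑ d : Fin K, q' u d = 1 := by simp [q']
  have hpen : ∑ v : X, (∑ d : Fin K, q' v d - 1) ^ 2 < ∑ v : X, (∑ d : Fin K, q v d - 1) ^ 2 := by
    apply Finset.sum_lt_sum
    · intro v _
      by_cases h : v = u
      · rw [h, hsu]
        nlinarith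
      · simp [q', h]
    · refine ⟨u, Finset.mem_univ u, ?_⟩
      rw [hsu]
      nlinarith
  have hm := hmin q' hbin'
  have hpen2 := mul_lt_mul_of_pos_left hpen hB
  unfold Ecorr pairSum at hm
  have hpair : ∑ p ∈ (Finset.univ : Finset X).offDiag,
      ((1 - S p.1 p.2) * ∑ c : Fin K, q' p.1 c * q' p.2 c
        + S p.1 p.2 * ∑ r ∈ (Finset.univ : Finset (Fin K)).offDiag, q' p.1 r.1 * q' p.2 r.2)
      ≤ ∑ p ∈ (Finset.univ : Finset X).offDiag,
      ((1 - S p.1 p.2) * ∑ c : Fin K, q p.1 c * q p.2 c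
        + S p.1 p.2 * ∑ r ∈ (Finset.univ : Finset (Fin K)).offDiag, q p.1 r.1 * q p.2 r.2) := by
    refine Finset.sum_le_sum fun p _ => add_le_add ?_ ?_
    · exact mul_le_mul_of_nonneg_left (Finset.sum_le_sum fun d _ => hmul _ _ _ _)
        (sub_nonneg.2 (hS1 _ _))
    · exact mul_le_mul_of_nonneg_left (Finset.sum_le_sum fun d _ => hmul _ _ _ _) (hS0 _ _)
  linarith
end

section
/- Let X be a finite set with |X| = n ≥ 1, K a positive integer, S : X → X → ℝ symmetric with 0 ≤ S u v ≤ 1 for all u, v, and B ≥ n. If q : X → Fin K → ℝ is a binary assignment (each q u c ∈ {0,1}) that minimizes the correlation-clustering QUBO energy E_corr over all binary assignments, then q satisfies the one-hot constraints: for every u ∈ X, Σ_c q u c = 1. Consequently q is the one-hot encoding of a unique clustering π̄ : X → Fin K defined by π̄ u = the unique c with q u c = 1. -/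
open Finset

theorem aux_term_le {K : ℕ} (s : ℝ) (h0 : 0 ≤ s) (h1 : s ≤ 1) (x y : Fin K → ℝ)
    (hx : ∀ c, 0 ≤ x c) (hy : ∀ c, 0 ≤ y c) :
    (1 - s) * ∑ c : Fin K, x c * y c
      + s * ∑ p ∈ (Finset.univ : Finset (Fin K)).offDiag, x p.1 * y p.2
      ≤ (∑ c, x c) * (∑ c, y c) := by
  have e : (∑ c, x c) * (∑ c, y c) = ∑ c : Fin K, x c * y c
      + ∑ p ∈ (Finset.univ : Finset (Fin K)).offDiag, x p.1 * y p.2 := by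
    rw [Finset.sum_mul_sum, ← Finset.sum_product', ← Finset.diag_union_offDiag,
      Finset.sum_union (Finset.disjoint_diag_offDiag _), Finset.sum_diag]
  have a : 0 ≤ ∑ c : Fin K, x c * y c := Finset.sum_nonneg fun c _ => mul_nonneg (hx _) (hy _)
  have b : 0 ≤ ∑ p ∈ (Finset.univ : Finset (Fin K)).offDiag, x p.1 * y p.2 :=
    Finset.sum_nonneg fun c _ => mul_nonneg (hx _) (hy _)
  rw [e]
  nlinarith

theorem aux_term_mono {K : ℕ} (s : ℝ) (h0 : 0 ≤ s) (h1 : s ≤ 1) (x y x' y' : Fin K → ℝ)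
    (hx : ∀ c, 0 ≤ x c) (hy : ∀ c, 0 ≤ y c) (hxx : ∀ c, x c ≤ x' c) (hyy : ∀ c, y c ≤ y' c) :
    (1 - s) * ∑ c : Fin K, x c * y c
      + s * ∑ p ∈ (Finset.univ : Finset (Fin K)).offDiag, x p.1 * y p.2
      ≤ (1 - s) * ∑ c : Fin K, x' c * y' c
      + s * ∑ p ∈ (Finset.univ : Finset (Fin K)).offDiag, x' p.1 * y' p.2 := by
  have h : ∀ c l, x c * y l ≤ x' c * y' l := fun c l =>
    mul_le_mul (hxx c) (hyy l) (hy l) ((hx c).trans (hxx c))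
  exact add_le_add
    (mul_le_mul_of_nonneg_left (Finset.sum_le_sum fun c _ => h c c) (by linarith))
    (mul_le_mul_of_nonneg_left (Finset.sum_le_sum fun c _ => h _ _) h0)

theorem aux_pen {X : Type} [Fintype X] [DecidableEq X] (u : X) (f g : X → ℝ)
    (h : ∀ a, f a ≤ g a - if a = u then 1 else 0) : ∑ a, f a ≤ ∑ a, g a - 1 := by
  have := Finset.sum_le_sum (s := Finset.univ) fun a _ => h a
  simpa [Finset.sum_sub_distrib] using this

theorem aux_pair {X : Type} [Fintype X] [DecidableEq X] (u : X) (f g : X → X → ℝ)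
    (h : ∀ a b, f a b ≤ g a b + ((if a = u then 1 else 0) + (if b = u then 1 else 0))) :
    pairSum f ≤ pairSum g + (Fintype.card X - 1) := by
  have := Finset.sum_le_sum (s := (Finset.univ : Finset X).offDiag) fun p _ => h p.1 p.2
  rw [Finset.sum_add_distrib] at this
  have e : ∑ p : X × X, ((if p.1 = u then (1:ℝ) else 0) + (if p.2 = u then 1 else 0))
      = 2 * Fintype.card X := by
    rw [Fintype.sum_prod_type]
    have e1 : ∀ x : X, ∑ y : X, ((if x = u then (1:ℝ) else 0) + (if y = u then 1 else 0))
        = (Fintype.card X : ℝ) * (if x = u then 1 else 0) + 1 := fun x => by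
      rw [Finset.sum_add_distrib, Finset.sum_const]
      simp only [Finset.sum_ite_eq', Finset.mem_univ, if_true, nsmul_eq_mul, Finset.card_univ]
    simp only [e1, Finset.sum_add_distrib, ← Finset.mul_sum, Finset.sum_ite_eq', Finset.mem_univ,
      if_true, Finset.sum_const, nsmul_eq_mul, Finset.card_univ]
    ring
  rw [← Finset.univ_product_univ, ← Finset.diag_union_offDiag,
      Finset.sum_union (Finset.disjoint_diag_offDiag _), Finset.sum_diag] at e
  simp only [Finset.sum_add_distrib, Finset.sum_ite_eq', Finset.mem_univ, if_true] at e this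
  unfold pairSum
  linarith

/-- if `|X| = n ≥ 1`, `0 ≤ S ≤ 1` symmetric, `B ≥ n`, and a binary assignment
`q` minimizes `E_corr` over all binary assignments, then `q` satisfies the one-hot
constraints `Σ_c q u c = 1` for every `u`, and consequently `q` is the one-hot encoding of
a unique clustering `π̄ : X → Fin K` (with `π̄ u` the unique `c` such that `q u c = 1`). -/
theorem minimizer_Ecorr_one_hot
    {X : Type} [Fintype X] [DecidableEq X] (K : ℕ) (hK : 0 < K)
    (n : ℕ) (hn : Fintype.card X = n) (hn1 : 1 ≤ n)
    (S : X → X → ℝ) (hSsymm : ∀ u v : X, S u v = S v u)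
    (hS0 : ∀ u v : X, 0 ≤ S u v) (hS1 : ∀ u v : X, S u v ≤ 1)
    (B : ℝ) (hB : (n : ℝ) ≤ B)
    (q : X → Fin K → ℝ) (hbin : ∀ (u : X) (c : Fin K), q u c = 0 ∨ q u c = 1)
    (hmin : ∀ q' : X → Fin K → ℝ, (∀ (u : X) (c : Fin K), q' u c = 0 ∨ q' u c = 1) →
      Ecorr S B q ≤ Ecorr S B q') :
    (∀ u : X, ∑ c : Fin K, q u c = 1) ∧
    (∃! πbar : X → Fin K, ∀ (u : X) (c : Fin K), q u c = if πbar u = c then 1 else 0) := by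
  have q0 : ∀ u c, 0 ≤ q u c := fun u c => by rcases hbin u c with h | h <;> simp [h]
  have hn1' : (1:ℝ) ≤ n := by exact_mod_cast hn1
  have hint : ∀ u, ∃ m : ℕ, ∑ c, q u c = m := by
    intro u
    have : ∀ c, ∃ m : ℕ, q u c = m := fun c => by
      rcases hbin u c with h | h
      · exact ⟨0, by simp [h]⟩
      · exact ⟨1, by simp [h]⟩
    choose m hm using this
    exact ⟨∑ c, m c, by simp [hm]⟩
  have hle : ∀ u, ∑ c, q u c ≤ 1 := by
    intro u
    by_contra hcon
    have h2 : 2 ≤ ∑ c, q u c := by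
      obtain ⟨m, hm⟩ := hint u
      rw [hm] at hcon ⊢
      have : ¬ m ≤ 1 := fun h => hcon (by exact_mod_cast h)
      have : 2 ≤ m := by omega
      exact_mod_cast this
    obtain ⟨c0, hc0⟩ : ∃ c, q u c = 1 := by
      by_contra hne
      push Not at hne
      have : ∑ c, q u c = 0 := Finset.sum_eq_zero fun c _ => (hbin u c).resolve_right (hne c)
      linarith
    set q' : X → Fin K → ℝ := fun a c => if a = u ∧ c = c0 then 0 else q a c with hq'
    have b' : ∀ a c, q' a c = 0 ∨ q' a c = 1 := fun a c => by
      by_cases h : a = u ∧ c = c0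
      · left; simp [hq', h]
      · simpa only [hq', if_neg h] using hbin a c
    have l' : ∀ a c, q' a c ≤ q a c := fun a c => by
      by_cases h : a = u ∧ c = c0
      · simp only [hq', if_pos h]; exact q0 _ _
      · simp only [hq', if_neg h]; exact le_rfl
    have n' : ∀ a c, 0 ≤ q' a c := fun a c => by rcases b' a c with h | h <;> simp [h]
    have hs : ∑ c, q' u c = ∑ c, q u c - 1 := by
      have : ∀ c, q' u c = q u c - if c = c0 then 1 else 0 := fun c => by
        by_cases h : c = c0 <;> simp [hq', h, hc0]
      simp [this, Finset.sum_sub_distrib]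
    have hne : ∀ a, a ≠ u → ∑ c, q' a c = ∑ c, q a c := fun a h => by simp [hq', h]
    have P := aux_pen u (fun a => (∑ c, q' a c - 1) ^ 2) (fun a => (∑ c, q a c - 1) ^ 2) (by
      intro a
      by_cases h : a = u
      · subst h
        simp only [hs, if_true]; nlinarith
      · simp [hne a h, h])
    have hm := hmin q' b'
    unfold Ecorr pairSum at hm
    have Q := Finset.sum_le_sum (s := (Finset.univ : Finset X).offDiag) fun p _ =>
      aux_term_mono (S p.1 p.2) (hS0 _ _) (hS1 _ _) (q' p.1) (q' p.2) (q p.1) (q p.2)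
        (n' _) (n' _) (l' _) (l' _)
    have := mul_le_mul_of_nonneg_left P (show 0 ≤ B by linarith)
    linarith
  have hone : ∀ u, ∑ c, q u c = 1 := by
    intro u
    by_contra hcon
    have h2 : ∑ c, q u c = 0 := by
      obtain ⟨m, hm⟩ := hint u
      have hl := hle u
      rw [hm] at hcon hl ⊢
      have h1 : m ≤ 1 := by exact_mod_cast hl
      have h3 : m ≠ 1 := fun h => hcon (by simp [h])
      have : m = 0 := by omega
      simp [this]
    set q' : X → Fin K → ℝ := fun a c => if a = u then (if c = ⟨0, hK⟩ then 1 else 0) else q a c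
      with hq'
    have b' : ∀ a c, q' a c = 0 ∨ q' a c = 1 := fun a c => by
      by_cases h : a = u
      · by_cases h' : c = ⟨0, hK⟩ <;> simp [hq', h, h']
      · simpa only [hq', if_neg h] using hbin a c
    have n' : ∀ a c, 0 ≤ q' a c := fun a c => by rcases b' a c with h | h <;> simp [h]
    have hs : ∑ c, q' u c = 1 := by simp [hq']
    have hne : ∀ a, a ≠ u → q' a = q a := fun a h => by funext c; simp [hq', h]
    have hle' : ∀ a, ∑ c, q' a c ≤ 1 := fun a => by
      by_cases h : a = u
      · rw [h, hs]
      · rw [hne a h]; exact hle a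
    have P := aux_pen u (fun a => (∑ c, q' a c - 1) ^ 2) (fun a => (∑ c, q a c - 1) ^ 2) (by
      intro a
      by_cases h : a = u
      · subst h
        simp [hs, h2]
      · simp [hne a h, h])
    have Q := aux_pair u
      (fun u v => (1 - S u v) * ∑ c : Fin K, q' u c * q' v c
        + S u v * ∑ p ∈ (Finset.univ : Finset (Fin K)).offDiag, q' u p.1 * q' v p.2)
      (fun u v => (1 - S u v) * ∑ c : Fin K, q u c * q v c
        + S u v * ∑ p ∈ (Finset.univ : Finset (Fin K)).offDiag, q u p.1 * q v p.2) (by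
      intro a b
      have t1 := aux_term_le (S a b) (hS0 _ _) (hS1 _ _) (q' a) (q' b) (n' _) (n' _)
      have t2 : (∑ c, q' a c) * (∑ c, q' b c) ≤ 1 :=
        mul_le_one₀ (hle' a) (Finset.sum_nonneg fun c _ => n' b c) (hle' b)
      have t3 := aux_term_mono (S a b) (hS0 _ _) (hS1 _ _) (fun _ => 0) (fun _ => 0) (q a) (q b)
        (fun _ => le_rfl) (fun _ => le_rfl) (q0 _) (q0 _)
      simp only [mul_zero, Finset.sum_const_zero, add_zero] at t3
      by_cases ha : a = u
      · have : (0:ℝ) ≤ if b = u then 1 else 0 := by split_ifs <;> norm_num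
        simp only [if_pos ha]
        linarith
      · by_cases hb : b = u
        · simp only [if_neg ha, if_pos hb]
          linarith
        · simp only [if_neg ha, if_neg hb, hne a ha, hne b hb]
          linarith)
    have hm := hmin q' b'
    unfold Ecorr at hm
    have := mul_le_mul_of_nonneg_left P (show 0 ≤ B by linarith)
    rw [hn] at Q
    linarith
  refine ⟨hone, ?_⟩
  have hex : ∀ u, ∃ c, q u c = 1 := by
    intro u
    by_contra hne
    push Not at hne
    have : ∑ c, q u c = 0 := Finset.sum_eq_zero fun c _ => (hbin u c).resolve_right (hne c)
    linarith [hone u]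
  choose f hf using hex
  refine ⟨f, ?_, ?_⟩
  · intro u c
    by_cases h : f u = c
    · rw [if_pos h, ← h, hf]
    · rw [if_neg h]
      refine (hbin u c).resolve_right fun h1 => ?_
      have := Finset.sum_le_sum_of_subset_of_nonneg (Finset.subset_univ {f u, c})
        fun i _ _ => q0 u i
      rw [Finset.sum_pair h, hone, hf, h1] at this
      linarith
  · intro g hg
    funext u
    have := hg u (f u)
    rw [hf] at this
    by_contra h
    rw [if_neg h] at this
    norm_num at this
end

section
/- Let X be a finite set with |X| = n ≥ 1, K a positive integer, S : X → X → ℝ symmetric with 0 ≤ S u v ≤ 1 for all u, v, and A ≥ n. If q : X → Fin K → ℝ is a binary assignment (each q u c ∈ {0,1}) that minimizes the pairwise-similarity QUBO energy E_sim over all binary assignments, then q satisfies the one-hot constraints: for every u ∈ X, Σ_c q u c = 1. -/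
open Finset

/-- The pairwise-similarity QUBO energy with penalty weight `A`:
`E_sim(q) = Σ_{{u,v} : u ≠ v} (1 − S u v)·Σ_c q u c · q v c + A · Σ_u (Σ_c q u c − 1)²`. -/
noncomputable def Esim {X : Type} [Fintype X] [DecidableEq X] {K : ℕ}
    (S : X → X → ℝ) (A : ℝ) (q : X → Fin K → ℝ) : ℝ :=
  pairSum (fun u v => (1 - S u v) * ∑ c : Fin K, q u c * q v c)
    + A * ∑ u : X, (∑ c : Fin K, q u c - 1) ^ 2

lemma penalty_flip {X : Type} [Fintype X] [DecidableEq X] {K : ℕ} (q : X → Fin K → ℝ)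
    (u0 : X) (c0 : Fin K) (d : ℝ) :
    ∑ u : X, (∑ c : Fin K, (q u c + if u = u0 ∧ c = c0 then d else 0) - 1) ^ 2
      = ∑ u : X, (∑ c : Fin K, q u c - 1) ^ 2
        + (2 * d * (∑ c : Fin K, q u0 c - 1) + d ^ 2) := by
  have h : ∀ u : X, (∑ c : Fin K, (q u c + if u = u0 ∧ c = c0 then d else 0) - 1) ^ 2
      = (∑ c : Fin K, q u c - 1) ^ 2
        + if u = u0 then (2 * d * (∑ c : Fin K, q u0 c - 1) + d ^ 2) else 0 := by
    intro u
    rw [Finset.sum_add_distrib]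
    by_cases hu : u = u0
    · subst hu
      simp
      ring
    · simp [hu]
  rw [Finset.sum_congr rfl (fun u _ => h u), Finset.sum_add_distrib]
  simp

lemma card_fst {X : Type} [Fintype X] [DecidableEq X] (u0 : X) :
    ∑ p ∈ (Finset.univ : Finset X).offDiag, (if p.1 = u0 then (1:ℝ) else 0)
      ≤ (Fintype.card X : ℝ) - 1 := by
  rw [Finset.sum_boole]
  have h1 : #{p ∈ (Finset.univ : Finset X).offDiag | p.1 = u0}
      ≤ #((Finset.univ.erase u0).image (fun v => (u0, v))) := by
    apply Finset.card_le_card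
    rintro ⟨a, b⟩ h
    simp at h ⊢
    grind
  have h2 := h1.trans Finset.card_image_le
  rw [Finset.card_erase_of_mem (Finset.mem_univ _), Finset.card_univ] at h2
  have h3 : 0 < Fintype.card X := Fintype.card_pos_iff.mpr ⟨u0⟩
  rw [le_sub_iff_add_le]
  exact_mod_cast (by omega)

lemma card_snd {X : Type} [Fintype X] [DecidableEq X] (u0 : X) :
    ∑ p ∈ (Finset.univ : Finset X).offDiag, (if p.2 = u0 then (1:ℝ) else 0)
      ≤ (Fintype.card X : ℝ) - 1 := by
  rw [Finset.sum_boole]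
  have h1 : #{p ∈ (Finset.univ : Finset X).offDiag | p.2 = u0}
      ≤ #((Finset.univ.erase u0).image (fun v => (v, u0))) := by
    apply Finset.card_le_card
    rintro ⟨a, b⟩ h
    simp at h ⊢
    grind
  have h2 := h1.trans Finset.card_image_le
  rw [Finset.card_erase_of_mem (Finset.mem_univ _), Finset.card_univ] at h2
  have h3 : 0 < Fintype.card X := Fintype.card_pos_iff.mpr ⟨u0⟩
  rw [le_sub_iff_add_le]
  exact_mod_cast (by omega)

/-- if `|X| = n ≥ 1`, `0 ≤ S ≤ 1` symmetric, `A ≥ n`, and a binary assignment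
`q` minimizes `E_sim` over all binary assignments, then `q` satisfies the one-hot
constraints: for every `u`, `Σ_c q u c = 1`. -/
theorem minimizer_Esim_one_hot
    {X : Type} [Fintype X] [DecidableEq X] (K : ℕ) (hK : 0 < K)
    (n : ℕ) (hn : Fintype.card X = n) (hn1 : 1 ≤ n)
    (S : X → X → ℝ) (hSsymm : ∀ u v : X, S u v = S v u)
    (hS0 : ∀ u v : X, 0 ≤ S u v) (hS1 : ∀ u v : X, S u v ≤ 1)
    (A : ℝ) (hA : (n : ℝ) ≤ A)
    (q : X → Fin K → ℝ) (hbin : ∀ (u : X) (c : Fin K), q u c = 0 ∨ q u c = 1)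
    (hmin : ∀ q' : X → Fin K → ℝ, (∀ (u : X) (c : Fin K), q' u c = 0 ∨ q' u c = 1) →
      Esim S A q ≤ Esim S A q') :
    ∀ u : X, ∑ c : Fin K, q u c = 1 := by
  intro u0
  have hq0 : ∀ u c, 0 ≤ q u c := fun u c => by rcases hbin u c with h | h <;> simp [h]
  have hq1 : ∀ u c, q u c ≤ 1 := fun u c => by rcases hbin u c with h | h <;> simp [h]
  have hn1' : (1 : ℝ) ≤ n := by exact_mod_cast hn1
  by_contra hne
  by_cases hz : ∀ c, q u0 c = 0
  · -- add a label
    let c0 : Fin K := ⟨0, hK⟩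
    have key := hmin (fun u c => q u c + if u = u0 ∧ c = c0 then 1 else 0) (by
      intro u c
      by_cases h : u = u0 ∧ c = c0
      · right; simp [h, hz]
      · simpa [h] using hbin u c)
    unfold Esim at key
    rw [penalty_flip] at key
    have hs : ∑ c : Fin K, q u0 c = 0 := by simp [hz]
    rw [hs] at key
    have hp : pairSum (fun u v => (1 - S u v) * ∑ c : Fin K,
          (q u c + if u = u0 ∧ c = c0 then 1 else 0) * (q v c + if v = u0 ∧ c = c0 then 1 else 0))
        ≤ pairSum (fun u v => (1 - S u v) * ∑ c : Fin K, q u c * q v c) + (n - 1) := by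
      unfold pairSum
      have ht : ∀ p ∈ (Finset.univ : Finset X).offDiag,
          (1 - S p.1 p.2) * ∑ c : Fin K, (q p.1 c + if p.1 = u0 ∧ c = c0 then 1 else 0) *
            (q p.2 c + if p.2 = u0 ∧ c = c0 then 1 else 0)
          ≤ (1 - S p.1 p.2) * ∑ c : Fin K, q p.1 c * q p.2 c
            + ((if p.1 = u0 then (1:ℝ) else 0) + (if p.2 = u0 then (1:ℝ) else 0)) := by
        rintro ⟨u, v⟩ huv
        have huv' : u ≠ v := by simpa using huv
        dsimp only
        have h1 : ∑ c : Fin K, (q u c + if u = u0 ∧ c = c0 then 1 else 0) *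
            (q v c + if v = u0 ∧ c = c0 then 1 else 0)
            ≤ ∑ c : Fin K, (q u c * q v c + if c = c0 then
              ((if u = u0 then (1:ℝ) else 0) + (if v = u0 then (1:ℝ) else 0)) else 0) := by
          apply Finset.sum_le_sum
          intro c _
          have := hq1 u c
          have := hq1 v c
          by_cases hc : c = c0
          · by_cases hu : u = u0
            · have hv : v ≠ u0 := fun h => huv' (hu.trans h.symm)
              simp only [hc, hu, hv, and_self, if_true, if_false, false_and]
              have := hq1 v c0
              linarith
            · by_cases hv : v = u0
              · simp only [hc, hu, hv, and_self, if_true, if_false, false_and]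
                have := hq1 u c0
                linarith
              · simp [hu, hv]
          · simp [hc]
        rw [Finset.sum_add_distrib, Finset.sum_ite_eq' Finset.univ c0] at h1
        simp only [Finset.mem_univ, if_true] at h1
        have hI : (0:ℝ) ≤ (if u = u0 then (1:ℝ) else 0) + (if v = u0 then (1:ℝ) else 0) := by
          positivity
        have a0 := hS0 u v
        have a1 := hS1 u v
        have h2 := mul_le_mul_of_nonneg_left h1 (by linarith : 0 ≤ 1 - S u v)
        nlinarith [mul_nonneg a0 hI]
      have h3 := Finset.sum_le_sum ht
      rw [Finset.sum_add_distrib, Finset.sum_add_distrib] at h3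
      have h4 := card_fst u0
      have h5 := card_snd u0
      rw [hn] at h4 h5
      linarith
    linarith
  · push Not at hz
    obtain ⟨c0, hc0⟩ := hz
    have hc1 : q u0 c0 = 1 := (hbin u0 c0).resolve_left hc0
    have hs : 2 ≤ ∑ c : Fin K, q u0 c := by
      by_cases hex : ∃ c1, c1 ≠ c0 ∧ q u0 c1 = 1
      · obtain ⟨c1, h10, h11⟩ := hex
        have := Finset.sum_le_sum_of_subset_of_nonneg (Finset.subset_univ {c1, c0})
          (fun c _ _ => hq0 u0 c)
        rw [Finset.sum_pair h10, h11, hc1] at this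
        linarith
      · exfalso
        apply hne
        rw [Finset.sum_eq_single c0 _ (by simp), hc1]
        intro c _ hc
        exact (hbin u0 c).resolve_right (fun h => hex ⟨c, hc, h⟩)
    have hb : ∀ u c, (q u c + if u = u0 ∧ c = c0 then (-1) else 0) = 0 ∨
        (q u c + if u = u0 ∧ c = c0 then (-1) else 0) = 1 := by
      intro u c
      by_cases h : u = u0 ∧ c = c0
      · left; simp [h, hc1]
      · simpa [h] using hbin u c
    have hle : ∀ u c, (q u c + if u = u0 ∧ c = c0 then (-1) else 0) ≤ q u c := by
      intro u c
      split_ifs <;> linarith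
    have key := hmin (fun u c => q u c + if u = u0 ∧ c = c0 then (-1) else 0) hb
    unfold Esim at key
    rw [penalty_flip] at key
    have hp : pairSum (fun u v => (1 - S u v) * ∑ c : Fin K,
          (q u c + if u = u0 ∧ c = c0 then (-1) else 0) *
            (q v c + if v = u0 ∧ c = c0 then (-1) else 0))
        ≤ pairSum (fun u v => (1 - S u v) * ∑ c : Fin K, q u c * q v c) := by
      unfold pairSum
      apply div_le_div_of_nonneg_right _ (by norm_num)
      apply Finset.sum_le_sum
      intro p _
      apply mul_le_mul_of_nonneg_left _ (by linarith [hS1 p.1 p.2])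
      apply Finset.sum_le_sum
      intro c _
      apply mul_le_mul (hle _ _) (hle _ _) _ (hq0 _ _)
      rcases hb p.2 c with h | h <;> rw [h] <;> norm_num
    nlinarith
end

section
/- (Theorem 1) Let X be a finite set with |X| = n ≥ 1, let S : X → X → ℝ be symmetric with 0 ≤ S u v ≤ 1 for all u, v, let B ≥ n, and take K = n. If q : X → Fin n → ℝ is a binary assignment (each q u c ∈ {0,1}) minimizing the correlation-clustering QUBO energy E_corr over all binary assignments, then q is the one-hot encoding of a clustering π̄ : X → Fin n, and π̄ minimizes the correlation clustering objective: for every clustering π : X → Fin n, f(π̄) ≤ f(π). -/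
open Finset

/-- The correlation clustering objective
`f(π) = Σ_{{u,v} : u ≠ v, π u = π v} (1 − S u v) + Σ_{{u,v} : u ≠ v, π u ≠ π v} S u v`. -/
noncomputable def corrObj {X : Type} [Fintype X] [DecidableEq X] {L : Type} [DecidableEq L]
    (S : X → X → ℝ) (π : X → L) : ℝ :=
  pairSum (fun u v => if π u = π v then 1 - S u v else 0)
    + pairSum (fun u v => if π u ≠ π v then S u v else 0)

/-- The pair term of the energy. -/
noncomputable def pTerm {K : ℕ} (s : ℝ) (a b : Fin K → ℝ) : ℝ :=
  (1 - s) * ∑ c : Fin K, a c * b c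
    + s * ∑ p ∈ (Finset.univ : Finset (Fin K)).offDiag, a p.1 * b p.2

lemma pTerm_onehot {K : ℕ} (s : ℝ) (i j : Fin K) :
    pTerm s (fun c => if i = c then 1 else 0) (fun c => if j = c then 1 else 0)
      = if i = j then 1 - s else s := by
  unfold pTerm
  have h1 : ∑ c : Fin K, (if i = c then (1:ℝ) else 0) * (if j = c then 1 else 0)
      = if i = j then 1 else 0 := by
    simp
  have h2 : ∑ p ∈ (Finset.univ : Finset (Fin K)).offDiag,
      (if i = p.1 then (1:ℝ) else 0) * (if j = p.2 then 1 else 0)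
      = if i = j then 0 else 1 := by
    have : ∀ p : Fin K × Fin K, (if i = p.1 then (1:ℝ) else 0) * (if j = p.2 then 1 else 0)
        = if (i, j) = p then 1 else 0 := by
      rintro ⟨a, b⟩
      by_cases h : i = a <;> by_cases h' : j = b <;> simp [h, h']
    simp only [this]
    rw [Finset.sum_ite_eq]
    by_cases h : i = j <;> simp [h]
  rw [h1, h2]
  by_cases h : i = j <;> simp [h]

lemma pTerm_nonneg {K : ℕ} (s : ℝ) (hs0 : 0 ≤ s) (hs1 : s ≤ 1) (a b : Fin K → ℝ)
    (ha : ∀ c, 0 ≤ a c) (hb : ∀ c, 0 ≤ b c) : 0 ≤ pTerm s a b := by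
  unfold pTerm
  have h1 : 0 ≤ ∑ c : Fin K, a c * b c :=
    Finset.sum_nonneg fun c _ => mul_nonneg (ha c) (hb c)
  have h2 : 0 ≤ ∑ p ∈ (Finset.univ : Finset (Fin K)).offDiag, a p.1 * b p.2 :=
    Finset.sum_nonneg fun p _ => mul_nonneg (ha _) (hb _)
  have : 0 ≤ 1 - s := by linarith
  positivity

lemma pTerm_mono {K : ℕ} (s : ℝ) (hs0 : 0 ≤ s) (hs1 : s ≤ 1) (a b a' b' : Fin K → ℝ)
    (ha : ∀ c, 0 ≤ a c) (hb : ∀ c, 0 ≤ b c) (haa : ∀ c, a c ≤ a' c) (hbb : ∀ c, b c ≤ b' c) :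
    pTerm s a b ≤ pTerm s a' b' := by
  unfold pTerm
  have h1 : ∑ c : Fin K, a c * b c ≤ ∑ c : Fin K, a' c * b' c :=
    Finset.sum_le_sum fun c _ => mul_le_mul (haa c) (hbb c) (hb c) ((ha c).trans (haa c))
  have h2 : ∑ p ∈ (Finset.univ : Finset (Fin K)).offDiag, a p.1 * b p.2
      ≤ ∑ p ∈ (Finset.univ : Finset (Fin K)).offDiag, a' p.1 * b' p.2 :=
    Finset.sum_le_sum fun p _ => mul_le_mul (haa _) (hbb _) (hb _) ((ha _).trans (haa _))
  exact add_le_add (mul_le_mul_of_nonneg_left h1 (by linarith))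
    (mul_le_mul_of_nonneg_left h2 hs0)

lemma Ecorr_eq {X : Type} [Fintype X] [DecidableEq X] {K : ℕ}
    (S : X → X → ℝ) (B : ℝ) (q : X → Fin K → ℝ) :
    Ecorr S B q = pairSum (fun u v => pTerm (S u v) (q u) (q v))
      + B * ∑ u : X, (∑ c : Fin K, q u c - 1) ^ 2 := rfl

lemma Ecorr_onehot {X : Type} [Fintype X] [DecidableEq X] {K : ℕ}
    (S : X → X → ℝ) (B : ℝ) (π : X → Fin K) :
    Ecorr S B (fun u c => if π u = c then 1 else 0)
      = pairSum (fun u v => if π u = π v then 1 - S u v else S u v) := by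
  rw [Ecorr_eq]
  simp [pTerm_onehot]

lemma corrObj_eq {X : Type} [Fintype X] [DecidableEq X] {K : ℕ}
    (S : X → X → ℝ) (π : X → Fin K) :
    corrObj S π = pairSum (fun u v => if π u = π v then 1 - S u v else S u v) := by
  unfold corrObj pairSum
  rw [← add_div, ← Finset.sum_add_distrib]
  congr 1
  refine Finset.sum_congr rfl fun p _ => ?_
  by_cases h : π p.1 = π p.2 <;> simp [h]

lemma pairSum_add_sum {X : Type} [Fintype X] [DecidableEq X] (b : X → ℝ) :
    pairSum (fun u v => b u + b v) = ((Fintype.card X : ℝ) - 1) * ∑ u, b u := by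
  unfold pairSum
  have h : ∑ p ∈ (Finset.univ : Finset X).offDiag, (b p.1 + b p.2)
      + ∑ p ∈ (Finset.univ : Finset X).diag, (b p.1 + b p.2)
      = ∑ p : X × X, (b p.1 + b p.2) := by
    rw [add_comm, ← Finset.sum_union (Finset.disjoint_diag_offDiag _),
      Finset.diag_union_offDiag, Finset.univ_product_univ]
  rw [Finset.sum_diag, Fintype.sum_prod_type] at h
  simp only [Finset.sum_add_distrib, Finset.sum_const, Finset.card_univ, nsmul_eq_mul,
    ← Finset.mul_sum] at h ⊢
  linarith

/-- Theorem 1: with `|X| = n ≥ 1`, `0 ≤ S ≤ 1` symmetric, `B ≥ n` and `K = n`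
clusters, any binary assignment `q` minimizing `E_corr` over all binary assignments is the
one-hot encoding of a clustering `π̄ : X → Fin n`, and `π̄` minimizes the correlation
clustering objective: `f(π̄) ≤ f(π)` for every clustering `π : X → Fin n`. -/
theorem minimizer_Ecorr_gives_optimal_correlation_clustering
    {X : Type} [Fintype X] [DecidableEq X]
    (n : ℕ) (hn : Fintype.card X = n) (hn1 : 1 ≤ n)
    (S : X → X → ℝ) (hSsymm : ∀ u v : X, S u v = S v u)
    (hS0 : ∀ u v : X, 0 ≤ S u v) (hS1 : ∀ u v : X, S u v ≤ 1)
    (B : ℝ) (hB : (n : ℝ) ≤ B)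
    (q : X → Fin n → ℝ) (hbin : ∀ (u : X) (c : Fin n), q u c = 0 ∨ q u c = 1)
    (hmin : ∀ q' : X → Fin n → ℝ, (∀ (u : X) (c : Fin n), q' u c = 0 ∨ q' u c = 1) →
      Ecorr S B q ≤ Ecorr S B q') :
    ∃ πbar : X → Fin n,
      (∀ (u : X) (c : Fin n), q u c = if πbar u = c then 1 else 0) ∧
      ∀ π : X → Fin n, corrObj S πbar ≤ corrObj S π := by
  have hq0 : ∀ u c, 0 ≤ q u c := fun u c => by rcases hbin u c with h | h <;> simp [h]
  have hex : ∀ u, ∃ c : Fin n, q u c = 1 ∨ ∀ c, q u c = 0 := by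
    intro u
    by_cases h : ∃ c, q u c = 1
    · exact h.imp fun c hc => Or.inl hc
    · refine ⟨⟨0, hn1⟩, Or.inr fun c => ?_⟩
      exact (hbin u c).resolve_right fun hc => h ⟨c, hc⟩
  choose π hπ using hex
  set b : X → ℝ := fun u => (∑ c : Fin n, q u c - 1) ^ 2 with hb
  have hb0 : ∀ u, 0 ≤ b u := fun u => sq_nonneg _
  have hbz : ∀ u, (∀ c, q u c = 0) → b u = 1 := by
    intro u hu
    simp [hb, hu]
  have hone : ∀ u c, (0:ℝ) ≤ if π u = c then 1 else 0 := by
    intro u c; split_ifs <;> norm_num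
  have hle : ∀ u, q u (π u) = 1 → ∀ c, (if π u = c then (1:ℝ) else 0) ≤ q u c := by
    intro u hu c
    split_ifs with h
    · rw [← h, hu]
    · exact hq0 u c
  have hterm : ∀ u v, (if π u = π v then 1 - S u v else S u v)
      ≤ pTerm (S u v) (q u) (q v) + (b u + b v) := by
    intro u v
    have h1 : (if π u = π v then 1 - S u v else S u v) ≤ 1 := by
      have := hS0 u v
      have := hS1 u v
      split_ifs <;> linarith
    have h0 := pTerm_nonneg (S u v) (hS0 u v) (hS1 u v) (q u) (q v) (hq0 u) (hq0 v)
    have hu0 := hb0 u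
    have hv0 := hb0 v
    rcases hπ u with hu | hu
    · rcases hπ v with hv | hv
      · have := pTerm_mono (S u v) (hS0 u v) (hS1 u v) _ _ (q u) (q v) (hone u) (hone v)
          (hle u hu) (hle v hv)
        rw [pTerm_onehot] at this
        linarith
      · have := hbz v hv
        linarith
    · have := hbz u hu
      linarith
  have hpair : pairSum (fun u v => if π u = π v then 1 - S u v else S u v)
      ≤ pairSum (fun u v => pTerm (S u v) (q u) (q v)) + ((n : ℝ) - 1) * ∑ u, b u := by
    have hps := pairSum_add_sum b
    rw [hn] at hps
    rw [← hps]
    unfold pairSum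
    rw [← add_div, ← Finset.sum_add_distrib]
    exact div_le_div_of_nonneg_right (Finset.sum_le_sum fun p _ => hterm p.1 p.2) (by norm_num)
  have hbinπ : ∀ (π : X → Fin n) (u : X) (c : Fin n),
      (if π u = c then (1:ℝ) else 0) = 0 ∨ (if π u = c then (1:ℝ) else 0) = 1 := by
    intro π u c
    by_cases h : π u = c <;> simp [h]
  have hE := hmin (fun u c => if π u = c then 1 else 0) (hbinπ π)
  rw [Ecorr_onehot, Ecorr_eq] at hE
  have hsum0 : 0 ≤ ∑ u, b u := Finset.sum_nonneg fun u _ => hb0 u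
  have hsum : ∑ u, b u = 0 := by
    change _ + B * ∑ u, b u ≤ _ at hE
    nlinarith [mul_nonneg (sub_nonneg.2 hB) hsum0]
  have hbu : ∀ u, b u = 0 := fun u =>
    (Finset.sum_eq_zero_iff_of_nonneg fun u _ => hb0 u).1 hsum u (Finset.mem_univ u)
  have hq : ∀ u c, q u c = if π u = c then 1 else 0 := by
    intro u c
    have hu : q u (π u) = 1 := by
      rcases hπ u with h | h
      · exact h
      · have := hbz u h
        rw [hbu u] at this
        norm_num at this
    have hr : ∑ c, q u c = ∑ c, if π u = c then (1:ℝ) else 0 := by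
      have := pow_eq_zero_iff (two_ne_zero) |>.1 (hbu u)
      simp
      linarith
    exact ((Finset.sum_eq_sum_iff_of_le fun c _ => hle u hu c).1 hr.symm c
      (Finset.mem_univ c)).symm
  refine ⟨π, hq, fun π' => ?_⟩
  have hE' := hmin (fun u c => if π' u = c then 1 else 0) (hbinπ π')
  have hqq : q = fun u c => if π u = c then 1 else 0 := by
    funext u c
    exact hq u c
  rw [hqq, Ecorr_onehot, Ecorr_onehot] at hE'
  rw [corrObj_eq, corrObj_eq]
  exact hE'
end

section
/- Let X be a finite set with |X| = n ≥ 1, let S : X → X → ℝ be symmetric with 0 ≤ S u v ≤ 1 for all u, v, let B ≥ n, and take K = n. Then the minimum of the correlation-clustering QUBO energy E_corr over all binary assignments q : X → Fin n → ℝ (each q u c ∈ {0,1}) equals the minimum of the correlation clustering objective f(π) over all clusterings π : X → Fin n. -/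
open Finset

lemma corrObj_eq_aux {X : Type} [Fintype X] [DecidableEq X] {L : Type} [DecidableEq L]
    (S : X → X → ℝ) (π : X → L) :
    corrObj S π = pairSum (fun u v => if π u = π v then 1 - S u v else S u v) := by
  unfold corrObj pairSum
  rw [← add_div, ← Finset.sum_add_distrib]
  congr 1
  apply Finset.sum_congr rfl
  intro p _
  by_cases h : π p.1 = π p.2 <;> simp [h]

lemma corrObj_nonneg_aux {X : Type} [Fintype X] [DecidableEq X] {L : Type} [DecidableEq L]
    (S : X → X → ℝ) (hS0 : ∀ u v : X, 0 ≤ S u v) (hS1 : ∀ u v : X, S u v ≤ 1) (π : X → L) :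
    0 ≤ corrObj S π := by
  rw [corrObj_eq_aux]
  unfold pairSum
  apply div_nonneg _ (by norm_num)
  apply Finset.sum_nonneg
  intro p _
  have := hS0 p.1 p.2
  have := hS1 p.1 p.2
  dsimp only
  split_ifs <;> linarith

lemma Ecorr_ind_aux {X : Type} [Fintype X] [DecidableEq X] {K : ℕ}
    (S : X → X → ℝ) (B : ℝ) (π : X → Fin K) :
    Ecorr S B (fun u c => if c = π u then 1 else 0) = corrObj S π := by
  rw [corrObj_eq_aux]
  unfold Ecorr
  have h0 : ∑ u : X, (∑ c : Fin K, (if c = π u then (1:ℝ) else 0) - 1) ^ 2 = 0 := by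
    apply Finset.sum_eq_zero
    intro u _
    simp
  rw [h0, mul_zero, add_zero]
  congr 1
  funext u v
  have h1 : ∑ c : Fin K, (if c = π u then (1:ℝ) else 0) * (if c = π v then 1 else 0)
      = if π u = π v then 1 else 0 := by
    simp [eq_comm]
  have h2 : ∑ p ∈ (Finset.univ : Finset (Fin K)).offDiag,
      (if p.1 = π u then (1:ℝ) else 0) * (if p.2 = π v then 1 else 0)
      = if π u = π v then 0 else 1 := by
    by_cases h : π u = π v
    · rw [if_pos h]
      apply Finset.sum_eq_zero
      intro p hp
      have hp := (Finset.mem_offDiag.1 hp).2.2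
      by_cases h3 : p.1 = π u
      · have : p.2 ≠ π v := fun h4 => hp (by rw [h3, h4, h])
        simp [this]
      · simp [h3]
    · rw [if_neg h, Finset.sum_eq_single (π u, π v)]
      · simp
      · intro p _ hp
        by_cases h3 : p.1 = π u
        · have : p.2 ≠ π v := fun h4 => hp (Prod.ext h3 h4)
          simp [this]
        · simp [h3]
      · intro h'
        exact absurd (Finset.mem_offDiag.2 ⟨Finset.mem_univ _, Finset.mem_univ _, h⟩) h'
  rw [h1, h2]
  split_ifs <;> ring

lemma exists_le_aux {X : Type} [Fintype X] [DecidableEq X]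
    (n : ℕ) (hn : Fintype.card X = n) (hn1 : 1 ≤ n)
    (S : X → X → ℝ)
    (hS0 : ∀ u v : X, 0 ≤ S u v) (hS1 : ∀ u v : X, S u v ≤ 1)
    (B : ℝ) (hB : (n : ℝ) ≤ B) (q : X → Fin n → ℝ)
    (hq : ∀ (u : X) (c : Fin n), q u c = 0 ∨ q u c = 1) :
    ∃ π : X → Fin n, corrObj S π ≤ Ecorr S B q := by
  have hex : ∀ u, ∃ c : Fin n, q u c = 1 ∨ ∀ c, q u c = 0 := by
    intro u
    by_cases h : ∃ c, q u c = 1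
    · obtain ⟨c, hc⟩ := h
      exact ⟨c, Or.inl hc⟩
    · push Not at h
      exact ⟨⟨0, hn1⟩, Or.inr fun c => (hq u c).resolve_right (h c)⟩
  choose π hπ using hex
  refine ⟨π, ?_⟩
  have hq0 : ∀ u c, 0 ≤ q u c := by
    intro u c
    rcases hq u c with h | h <;> rw [h] <;> norm_num
  rw [corrObj_eq_aux]
  unfold Ecorr
  set z : X → ℝ := fun u => (∑ c : Fin n, q u c - 1) ^ 2 with hz
  have hz0 : ∀ u, 0 ≤ z u := fun u => sq_nonneg _
  have hz1 : ∀ u, (∀ c, q u c = 0) → z u = 1 := by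
    intro u h
    simp [hz, h]
  set T : X → X → ℝ := fun u v => (1 - S u v) * ∑ c : Fin n, q u c * q v c
        + S u v * ∑ p ∈ (Finset.univ : Finset (Fin n)).offDiag, q u p.1 * q v p.2 with hT
  have hkey : ∀ u v, (if π u = π v then 1 - S u v else S u v) ≤ T u v + (z u + z v) := by
    intro u v
    have s0 := hS0 u v
    have s1 := hS1 u v
    have a0 : 0 ≤ ∑ c : Fin n, q u c * q v c :=
      Finset.sum_nonneg fun c _ => mul_nonneg (hq0 _ _) (hq0 _ _)
    have b0 : 0 ≤ ∑ p ∈ (Finset.univ : Finset (Fin n)).offDiag, q u p.1 * q v p.2 :=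
      Finset.sum_nonneg fun c _ => mul_nonneg (hq0 _ _) (hq0 _ _)
    have t1 := mul_nonneg (sub_nonneg.2 s1) a0
    have t2 := mul_nonneg s0 b0
    have zu := hz0 u
    have zv := hz0 v
    have hle : (if π u = π v then 1 - S u v else S u v) ≤ 1 := by
      split_ifs <;> linarith
    have hTe : T u v = (1 - S u v) * ∑ c : Fin n, q u c * q v c
        + S u v * ∑ p ∈ (Finset.univ : Finset (Fin n)).offDiag, q u p.1 * q v p.2 := rfl
    rcases hπ u with hu | hu
    · rcases hπ v with hv | hv
      · split_ifs with h
        · have a1 : q u (π u) * q v (π u) ≤ ∑ c : Fin n, q u c * q v c :=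
            Finset.single_le_sum (f := fun c => q u c * q v c)
              (fun c _ => mul_nonneg (hq0 _ _) (hq0 _ _)) (Finset.mem_univ _)
          have hv' : q v (π u) = 1 := by rw [h]; exact hv
          rw [hu, hv', one_mul] at a1
          have := mul_le_mul_of_nonneg_left a1 (sub_nonneg.2 s1)
          linarith
        · have b1 : q u (π u) * q v (π v) ≤
              ∑ p ∈ (Finset.univ : Finset (Fin n)).offDiag, q u p.1 * q v p.2 :=
            Finset.single_le_sum (f := fun p : Fin n × Fin n => q u p.1 * q v p.2)
              (a := (π u, π v))
              (fun c _ => mul_nonneg (hq0 _ _) (hq0 _ _))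
              (Finset.mem_offDiag.2 ⟨Finset.mem_univ _, Finset.mem_univ _, h⟩)
          rw [hu, hv, one_mul] at b1
          have := mul_le_mul_of_nonneg_left b1 s0
          linarith
      · have := hz1 v hv
        linarith
    · have := hz1 u hu
      linarith
  have hsum : ∑ p ∈ (Finset.univ : Finset X).offDiag, (z p.1 + z p.2) ≤ 2 * (n * ∑ u, z u) := by
    calc ∑ p ∈ (Finset.univ : Finset X).offDiag, (z p.1 + z p.2)
        ≤ ∑ p : X × X, (z p.1 + z p.2) :=
          Finset.sum_le_sum_of_subset_of_nonneg (Finset.subset_univ _)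
            fun p _ _ => add_nonneg (hz0 _) (hz0 _)
      _ = 2 * (n * ∑ u, z u) := by
          rw [Fintype.sum_prod_type]
          simp only [Finset.sum_add_distrib, Finset.sum_const, Finset.card_univ, hn,
            nsmul_eq_mul, ← Finset.mul_sum]
          ring
  have hBz : n * ∑ u, z u ≤ B * ∑ u, z u :=
    mul_le_mul_of_nonneg_right hB (Finset.sum_nonneg fun u _ => hz0 u)
  have hmain := Finset.sum_le_sum
    (fun (p : X × X) (_ : p ∈ (Finset.univ : Finset X).offDiag) => hkey p.1 p.2)
  rw [Finset.sum_add_distrib] at hmain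
  unfold pairSum
  linarith

/-- with `|X| = n ≥ 1`, `0 ≤ S ≤ 1` symmetric, `B ≥ n` and `K = n` clusters,
the minimum of the correlation-clustering QUBO energy `E_corr` over all binary assignments
equals the minimum of the correlation clustering objective `f` over all clusterings
`π : X → Fin n`. -/
theorem min_Ecorr_eq_min_corrObj
    {X : Type} [Fintype X] [DecidableEq X]
    (n : ℕ) (hn : Fintype.card X = n) (hn1 : 1 ≤ n)
    (S : X → X → ℝ) (hSsymm : ∀ u v : X, S u v = S v u)
    (hS0 : ∀ u v : X, 0 ≤ S u v) (hS1 : ∀ u v : X, S u v ≤ 1)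
    (B : ℝ) (hB : (n : ℝ) ≤ B) :
    sInf {x : ℝ | ∃ q : X → Fin n → ℝ,
        (∀ (u : X) (c : Fin n), q u c = 0 ∨ q u c = 1) ∧ Ecorr S B q = x} =
      sInf {x : ℝ | ∃ π : X → Fin n, corrObj S π = x} := by
  apply le_antisymm
  · apply le_csInf
    · exact ⟨_, fun _ => ⟨0, hn1⟩, rfl⟩
    · rintro x ⟨π, rfl⟩
      apply csInf_le
      · refine ⟨0, ?_⟩
        rintro y ⟨q, hq, rfl⟩
        obtain ⟨ρ, hρ⟩ := exists_le_aux n hn hn1 S hS0 hS1 B hB q hq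
        exact (corrObj_nonneg_aux S hS0 hS1 ρ).trans hρ
      · refine ⟨fun u c => if c = π u then 1 else 0, ?_, Ecorr_ind_aux S B π⟩
        intro u c
        by_cases h : c = π u <;> simp [h]
  · apply le_csInf
    · exact ⟨_, fun _ _ => 0, fun _ _ => Or.inl rfl, rfl⟩
    · rintro x ⟨q, hq, rfl⟩
      obtain ⟨ρ, hρ⟩ := exists_le_aux n hn hn1 S hS0 hS1 B hB q hq
      refine le_trans (csInf_le ?_ ⟨ρ, rfl⟩) hρ
      refine ⟨0, ?_⟩
      rintro y ⟨π, rfl⟩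
      exact corrObj_nonneg_aux S hS0 hS1 π
end

section
/- Let X be a finite set with |X| = n ≥ 1, K a positive integer, S : X → X → ℝ symmetric with 0 ≤ S u v ≤ 1 for all u, v, and A ≥ n. If q : X → Fin K → ℝ is a binary assignment (each q u c ∈ {0,1}) minimizing the pairwise-similarity QUBO energy E_sim over all binary assignments, then q is the one-hot encoding of a clustering π̄ : X → Fin K, and π̄ minimizes the within-cluster dissimilarity: for every clustering π : X → Fin K, g(π̄) ≤ g(π). -/
open Finset

/-- The within-cluster dissimilarity objective
`g(π) = Σ_{{u,v} : u ≠ v, π u = π v} (1 − S u v)`. -/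
noncomputable def withinObj {X : Type} [Fintype X] [DecidableEq X] {K : ℕ}
    (S : X → X → ℝ) (π : X → Fin K) : ℝ :=
  pairSum (fun u v => if π u = π v then 1 - S u v else 0)

lemma Esim_onehot_aux {X : Type} [Fintype X] [DecidableEq X] {K : ℕ}
    (S : X → X → ℝ) (A : ℝ) (π : X → Fin K) :
    Esim S A (fun u c => if π u = c then 1 else 0) = withinObj S π := by
  unfold Esim withinObj pairSum
  simp [eq_comm]

lemma pen_update_aux {X : Type} [Fintype X] [DecidableEq X] {K : ℕ}
    (q : X → Fin K → ℝ) (u : X) (r : Fin K → ℝ) :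
    ∑ v : X, (∑ c, Function.update q u r v c - 1) ^ 2
      = ∑ v : X, (∑ c, q v c - 1) ^ 2 + ((∑ c, r c - 1) ^ 2 - (∑ c, q u c - 1) ^ 2) := by
  have h : ∀ v : X, (∑ c, Function.update q u r v c - 1) ^ 2
      = (∑ c, q v c - 1) ^ 2 +
        (if v = u then ((∑ c, r c - 1) ^ 2 - (∑ c, q u c - 1) ^ 2) else 0) := by
    intro v
    by_cases hv : v = u
    · subst hv; simp
    · simp [hv]
  simp_rw [h, Finset.sum_add_distrib]
  simp

lemma offDiag_count_aux {X : Type} [Fintype X] [DecidableEq X] (u : X) :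
    ∑ p ∈ (Finset.univ : Finset X).offDiag,
      ((if p.1 = u then (1:ℝ) else 0) + (if p.2 = u then 1 else 0))
      = 2 * ((Fintype.card X : ℝ) - 1) := by
  have h : ∑ p ∈ (Finset.univ : Finset X).offDiag,
      ((if p.1 = u then (1:ℝ) else 0) + (if p.2 = u then 1 else 0))
      + ∑ p ∈ (Finset.univ : Finset X).diag,
      ((if p.1 = u then (1:ℝ) else 0) + (if p.2 = u then 1 else 0))
      = ∑ p : X × X, ((if p.1 = u then (1:ℝ) else 0) + (if p.2 = u then 1 else 0)) := by
    rw [add_comm, ← Finset.sum_union (Finset.disjoint_diag_offDiag _),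
      Finset.diag_union_offDiag, Finset.univ_product_univ]
  rw [Finset.sum_diag, Fintype.sum_prod_type] at h
  have h1 : ∑ x : X, ∑ y : X, ((if x = u then (1:ℝ) else 0) + (if y = u then 1 else 0))
      = 2 * (Fintype.card X : ℝ) := by
    simp only [Finset.sum_add_distrib, Finset.sum_const, Finset.card_univ, nsmul_eq_mul,
      ← Finset.mul_sum, Finset.sum_ite_eq', Finset.mem_univ, if_true]
    ring
  have h2 : ∑ x : X, ((if x = u then (1:ℝ) else 0) + (if x = u then 1 else 0)) = 2 := by
    simp only [Finset.sum_add_distrib, Finset.sum_ite_eq', Finset.mem_univ, if_true]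
    norm_num
  rw [h1, h2] at h
  linarith

theorem minimizer_Esim_gives_optimal_within_cluster
    {X : Type} [Fintype X] [DecidableEq X] (K : ℕ) (hK : 0 < K)
    (n : ℕ) (hn : Fintype.card X = n) (hn1 : 1 ≤ n)
    (S : X → X → ℝ) (hSsymm : ∀ u v : X, S u v = S v u)
    (hS0 : ∀ u v : X, 0 ≤ S u v) (hS1 : ∀ u v : X, S u v ≤ 1)
    (A : ℝ) (hA : (n : ℝ) ≤ A)
    (q : X → Fin K → ℝ) (hbin : ∀ (u : X) (c : Fin K), q u c = 0 ∨ q u c = 1)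
    (hmin : ∀ q' : X → Fin K → ℝ, (∀ (u : X) (c : Fin K), q' u c = 0 ∨ q' u c = 1) →
      Esim S A q ≤ Esim S A q') :
    ∃ πbar : X → Fin K,
      (∀ (u : X) (c : Fin K), q u c = if πbar u = c then 1 else 0) ∧
      ∀ π : X → Fin K, withinObj S πbar ≤ withinObj S π := by
  have hn1' : (1:ℝ) ≤ n := by exact_mod_cast hn1
  have hq0 : ∀ u c, 0 ≤ q u c := fun u c => by rcases hbin u c with h | h <;> simp [h]
  have hq1 : ∀ u c, q u c ≤ 1 := fun u c => by rcases hbin u c with h | h <;> simp [h]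
  -- some one in every row
  have hex : ∀ u, ∃ c, q u c = 1 := by
    intro u
    by_contra hne
    push Not at hne
    have hz : ∀ c, q u c = 0 := fun c => (hbin u c).resolve_right (hne c)
    let c0 : Fin K := ⟨0, hK⟩
    let r : Fin K → ℝ := fun c => if c = c0 then 1 else 0
    have hb : ∀ v c, Function.update q u r v c = 0 ∨ Function.update q u r v c = 1 := by
      intro v c
      by_cases hv : v = u
      · subst hv
        by_cases hc : c = c0 <;> simp [r, hc]
      · simpa [hv] using hbin v c
    have h1 := hmin _ hb
    unfold Esim at h1
    rw [pen_update_aux] at h1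
    have hr : ∑ c, r c = 1 := by simp [r]
    have hs : ∑ c, q u c = 0 := by simp [hz]
    rw [hr, hs] at h1
    have h2 : pairSum (fun a b => (1 - S a b) * ∑ c, Function.update q u r a c *
          Function.update q u r b c)
        ≤ pairSum (fun a b => (1 - S a b) * ∑ c, q a c * q b c) + (n - 1) := by
      have hc := offDiag_count_aux u
      rw [hn] at hc
      unfold pairSum
      have : ∑ p ∈ (Finset.univ : Finset X).offDiag, (1 - S p.1 p.2) *
            ∑ c, Function.update q u r p.1 c * Function.update q u r p.2 c
          ≤ ∑ p ∈ (Finset.univ : Finset X).offDiag,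
            ((1 - S p.1 p.2) * ∑ c, q p.1 c * q p.2 c +
            ((if p.1 = u then (1:ℝ) else 0) + (if p.2 = u then 1 else 0))) := by
        apply Finset.sum_le_sum
        rintro ⟨a, b⟩ hab
        have hab' : a ≠ b := by simpa using hab
        have s0 := hS0 a b
        have s1 := hS1 a b
        by_cases ha : a = u
        · subst ha
          have hb' : b ≠ a := hab'.symm
          simp only [Function.update_self, Function.update_of_ne hb', hz, r]
          simp [hb']
          nlinarith [hq0 b c0, hq1 b c0]
        · by_cases hbu : b = u
          · subst hbu
            simp only [Function.update_self, Function.update_of_ne hab', hz, r]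
            simp [hab']
            nlinarith [hq0 a c0, hq1 a c0]
          · simp [ha, hbu]
      rw [Finset.sum_add_distrib, hc] at this
      linarith
    nlinarith
  have huniq : ∀ u c d, q u c = 1 → q u d = 1 → c = d := by
    intro u c d hc hd
    by_contra hcd
    let r : Fin K → ℝ := Function.update (q u) c 0
    have hr0 : ∀ e, 0 ≤ r e := by
      intro e
      by_cases he : e = c
      · subst he; simp [r]
      · simpa [r, he] using hq0 u e
    have hrq : ∀ e, r e ≤ q u e := by
      intro e
      by_cases he : e = c
      · subst he; simp [r, hc]
      · simp [r, he]
    have hb : ∀ v e, Function.update q u r v e = 0 ∨ Function.update q u r v e = 1 := by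
      intro v e
      by_cases hv : v = u
      · subst hv
        by_cases he : e = c
        · subst he; simp [r]
        · simpa [r, he] using hbin v e
      · simpa [hv] using hbin v e
    have hu0 : ∀ v e, 0 ≤ Function.update q u r v e := fun v e => by
      rcases hb v e with h | h <;> simp [h]
    have huq : ∀ v e, Function.update q u r v e ≤ q v e := by
      intro v e
      by_cases hv : v = u
      · subst hv; simpa using hrq e
      · simp [hv]
    have h1 := hmin _ hb
    unfold Esim at h1
    rw [pen_update_aux] at h1
    have hrs : ∑ e, q u e = ∑ e, r e + 1 := by
      have e1 := Finset.add_sum_erase Finset.univ (q u) (Finset.mem_univ c)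
      have e2 := Finset.add_sum_erase Finset.univ r (Finset.mem_univ c)
      have e3 : ∑ e ∈ Finset.univ.erase c, r e = ∑ e ∈ Finset.univ.erase c, q u e := by
        apply Finset.sum_congr rfl
        intro e he
        simp [r, (Finset.mem_erase.mp he).1]
      have e4 : r c = 0 := by simp [r]
      linarith
    have hr1 : 1 ≤ ∑ e, r e := by
      have : r d = 1 := by simp [r, Ne.symm hcd, hd]
      rw [← this]
      exact Finset.single_le_sum (fun e _ => hr0 e) (Finset.mem_univ d)
    rw [hrs] at h1
    have h2 : pairSum (fun a b => (1 - S a b) * ∑ c, Function.update q u r a c *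
          Function.update q u r b c)
        ≤ pairSum (fun a b => (1 - S a b) * ∑ c, q a c * q b c) := by
      unfold pairSum
      apply div_le_div_of_nonneg_right _ (by norm_num)
      apply Finset.sum_le_sum
      intro p _
      apply mul_le_mul_of_nonneg_left _ (by linarith [hS1 p.1 p.2])
      apply Finset.sum_le_sum
      intro e _
      exact mul_le_mul (huq _ _) (huq _ _) (hu0 _ _) (hq0 _ _)
    nlinarith
  choose πbar hπ using hex
  have hone : ∀ (u : X) (c : Fin K), q u c = if πbar u = c then 1 else 0 := by
    intro u c
    split_ifs with h
    · rw [← h]; exact hπ u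
    · exact (hbin u c).resolve_right (fun h1 => h (huniq u _ _ (hπ u) h1))
  refine ⟨πbar, hone, fun π => ?_⟩
  have hq : q = fun u c => if πbar u = c then 1 else 0 := by
    funext u c; exact hone u c
  rw [← Esim_onehot_aux S A πbar, ← Esim_onehot_aux S A π, ← hq]
  apply hmin
  intro u c
  by_cases h : π u = c <;> simp [h]
end

section
/- Let X be a finite set, m ≥ 1, and let π₁, …, π_m : X → ℕ be base clusterings with pairwise similarity S u v = (1/m) · |{i : π_i u = π_i v}|. For any clustering π : X → ℕ, the total partition difference satisfies Σ_{i=1}^m d(π_i, π) = m · [Σ_{{u,v} : u ≠ v, π u = π v} (1 − S u v) + Σ_{{u,v} : u ≠ v, π u ≠ π v} S u v], where d(π', π) is the number of unordered pairs {u,v} of distinct points on which π' and π disagree (exactly one of them assigns u and v to the same cluster). That is, the partition-difference consensus objective equals m times the correlation clustering objective. -/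
open Finset

/-- The pairwise disagreement indicator `d_{u,v}(π', π)`: equals `1` if exactly one of the
clusterings `π', π` assigns `u` and `v` to the same cluster, and `0` otherwise. -/
noncomputable def dInd {X : Type} (π' π : X → ℕ) (u v : X) : ℝ :=
  if (π' u = π' v ∧ π u ≠ π v) ∨ (π' u ≠ π' v ∧ π u = π v) then 1 else 0

/-- The distance `d(π', π)` between two clusterings: the number of unordered pairs `{u,v}`
of distinct points on which `π'` and `π` disagree. -/
noncomputable def dDist {X : Type} [Fintype X] [DecidableEq X] (π' π : X → ℕ) : ℝ :=
  pairSum (fun u v => dInd π' π u v)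

/-- given `m ≥ 1` base clusterings with pairwise similarity
`S u v = (1/m)·|{i : π_i u = π_i v}|`, for any clustering `π : X → ℕ` the total partition
difference `Σ_i d(π_i, π)` equals `m` times the correlation clustering objective
`Σ_{{u,v} : u ≠ v, π u = π v} (1 − S u v) + Σ_{{u,v} : u ≠ v, π u ≠ π v} S u v`. -/
theorem partition_difference_eq_m_mul_correlation_objective
    {X : Type} [Fintype X] [DecidableEq X]
    (m : ℕ) (hm : 1 ≤ m) (πs : Fin m → X → ℕ) (S : X → X → ℝ)
    (hS : ∀ u v : X,
      S u v = ((Finset.univ.filter fun i : Fin m => πs i u = πs i v).card : ℝ) / m)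
    (π : X → ℕ) :
    ∑ i : Fin m, dDist (πs i) π =
      m * (pairSum (fun u v => if π u = π v then 1 - S u v else 0)
            + pairSum (fun u v => if π u ≠ π v then S u v else 0)) := by
  have hm0 : (m : ℝ) ≠ 0 := by
    have : m ≠ 0 := by omega
    exact_mod_cast this
  have hmS : ∀ u v : X, (m : ℝ) * S u v = ∑ i : Fin m, if πs i u = πs i v then (1 : ℝ) else 0 := by
    intro u v
    rw [hS, mul_div_cancel₀ _ hm0, Finset.sum_boole]
  have key : ∀ u v : X, ∑ i : Fin m, dInd (πs i) π u v =
      m * ((if π u = π v then 1 - S u v else 0) + (if π u ≠ π v then S u v else 0)) := by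
    intro u v
    by_cases h : π u = π v
    · have h1 : (m : ℝ) = ∑ i : Fin m, (1 : ℝ) := by simp
      simp only [h, ne_eq, not_true_eq_false, if_true, if_false, add_zero, mul_sub, mul_one, hmS]
      conv_rhs => rw [h1]
      rw [← Finset.sum_sub_distrib]
      refine Finset.sum_congr rfl fun i _ => ?_
      by_cases h2 : πs i u = πs i v <;> simp [dInd, h, h2]
    · simp only [h, ne_eq, not_false_eq_true, if_true, if_false, zero_add, hmS]
      refine Finset.sum_congr rfl fun i _ => ?_
      by_cases h2 : πs i u = πs i v <;> simp [dInd, h, h2]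
  unfold dDist pairSum
  rw [← Finset.sum_div, Finset.sum_comm, ← add_div, ← Finset.sum_add_distrib, ← mul_div_assoc,
    Finset.mul_sum]
  congr 1
  exact Finset.sum_congr rfl fun p _ => key p.1 p.2
end
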